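/- arXiv:1710.07402 — 10 statements merged into one kernel-verified Lean document; each statement's English description precedes it below -/
import Mathlib

section
/- The weak Collatz–Wielandt quotient satisfies ρ̂(A,B) > 0 if and only if every column of A is nonzero, i.e., Aᵀ𝟙_m > 0 entrywise (equivalently, the union of the supports of the rows of A is all of [n]). -/
open Matrix
open scoped ENNReal

/-- `r(A,B,x) = inf{t ∈ [0,∞] : A x ≤ t B x entrywise}`, valued in `ℝ≥0∞`
(the infimum of the empty set being `⊤`). -/
noncomputable def cwR {m n : ℕ} (A B : Matrix (Fin m) (Fin n) ℝ) (x : Fin n → ℝ) : ℝ≥0∞ :=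
  sInf {t : ℝ≥0∞ | ∃ s : ℝ, 0 ≤ s ∧ t = ENNReal.ofReal s ∧
    ∀ i, A.mulVec x i ≤ s * B.mulVec x i}

/-- The weak Collatz–Wielandt quotient `ρ̂(A,B) = inf{r(A,B,x) : x ≥ 0, x ≠ 0}`. -/
noncomputable def cwRhoHat {m n : ℕ} (A B : Matrix (Fin m) (Fin n) ℝ) : ℝ≥0∞ :=
  sInf {t : ℝ≥0∞ | ∃ x : Fin n → ℝ, (∀ j, 0 ≤ x j) ∧ x ≠ 0 ∧ t = cwR A B x}

theorem sum_mulVec_eq_sum_transpose {m n : ℕ} (A : Matrix (Fin m) (Fin n) ℝ) (x : Fin n → ℝ) :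
    ∑ i, A.mulVec x i = ∑ j, Aᵀ.mulVec (fun _ => 1) j * x j := by
  simp only [Matrix.mulVec, dotProduct, Matrix.transpose_apply, mul_one, Finset.sum_mul]
  exact Finset.sum_comm

/-- If the column sums of `A` are at least `c` and those of `B` at most `C`, then
every `s` with `A x ≤ s B x` is at least `c / C`. -/
theorem div_le_of_mulVec_le {m n : ℕ} {A B : Matrix (Fin m) (Fin n) ℝ} {c C s : ℝ}
    (hC : 0 < C) (hAc : ∀ j, c ≤ Aᵀ.mulVec (fun _ => 1) j)
    (hBC : ∀ j, Bᵀ.mulVec (fun _ => 1) j ≤ C) {x : Fin n → ℝ} (hx : ∀ j, 0 ≤ x j)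
    (hx0 : x ≠ 0) (hs : 0 ≤ s) (h : ∀ i, A.mulVec x i ≤ s * B.mulVec x i) :
    c / C ≤ s := by
  obtain ⟨k, hk⟩ := Function.ne_iff.mp hx0
  have hpos : 0 < ∑ j, x j :=
    Finset.sum_pos' (fun j _ => hx j) ⟨k, Finset.mem_univ k, lt_of_le_of_ne (hx k) (Ne.symm hk)⟩
  rw [div_le_iff₀ hC]
  refine le_of_mul_le_mul_right ?_ hpos
  calc c * ∑ j, x j ≤ ∑ j, Aᵀ.mulVec (fun _ => 1) j * x j := by
        rw [Finset.mul_sum]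
        exact Finset.sum_le_sum fun j _ => mul_le_mul_of_nonneg_right (hAc j) (hx j)
    _ = ∑ i, A.mulVec x i := (sum_mulVec_eq_sum_transpose A x).symm
    _ ≤ s * ∑ i, B.mulVec x i := by
        rw [Finset.mul_sum]
        exact Finset.sum_le_sum fun i _ => h i
    _ = s * ∑ j, Bᵀ.mulVec (fun _ => 1) j * x j := by rw [sum_mulVec_eq_sum_transpose]
    _ ≤ s * (C * ∑ j, x j) := by
        rw [Finset.mul_sum Finset.univ x C]
        exact mul_le_mul_of_nonneg_left
          (Finset.sum_le_sum fun j _ => mul_le_mul_of_nonneg_right (hBC j) (hx j)) hs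
    _ = s * C * ∑ j, x j := (mul_assoc _ _ _).symm

theorem cwRhoHat_eq_zero_of_column_eq_zero {m n : ℕ} {A B : Matrix (Fin m) (Fin n) ℝ} {j : Fin n}
    (h : ∀ i, A i j = 0) : cwRhoHat A B = 0 := by
  have hr : cwR A B (Pi.single j 1) = 0 :=
    le_antisymm (sInf_le ⟨0, le_rfl, by simp, fun i => by simp [h]⟩) zero_le
  refine le_antisymm (sInf_le ⟨Pi.single j 1, fun k => ?_, ?_, hr.symm⟩) zero_le
  · exact (Pi.single_nonneg.mpr zero_le_one : (0 : Fin n → ℝ) ≤ Pi.single j 1) k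
  · simp

theorem stmt1 {m n : ℕ} (hm : 0 < m) (hn : 0 < n)
    (A B : Matrix (Fin m) (Fin n) ℝ)
    (hA : ∀ i j, 0 ≤ A i j) (hB : ∀ i j, 0 ≤ B i j) :
    0 < cwRhoHat A B ↔ ∀ j : Fin n, 0 < Aᵀ.mulVec (fun _ => 1) j := by
  constructor
  · intro h j
    have hsum : Aᵀ.mulVec (fun _ => 1) j = ∑ i, A i j := by simp [Matrix.mulVec, dotProduct]
    rw [hsum]
    refine (Finset.sum_nonneg fun i _ => hA i j).lt_of_ne fun h0 => h.ne' ?_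
    refine cwRhoHat_eq_zero_of_column_eq_zero (j := j) fun i => ?_
    exact (Finset.sum_eq_zero_iff_of_nonneg fun i _ => hA i j).mp h0.symm i (Finset.mem_univ i)
  · intro h
    have : Nonempty (Fin n) := ⟨⟨0, hn⟩⟩
    obtain ⟨j₀, hj₀⟩ := Finite.exists_min (Aᵀ.mulVec fun _ => 1)
    obtain ⟨j₁, hj₁⟩ := Finite.exists_max (Bᵀ.mulVec fun _ => 1)
    have hB₁ : 0 ≤ Bᵀ.mulVec (fun _ => 1) j₁ := by
      simpa [Matrix.mulVec, dotProduct] using Finset.sum_nonneg fun i _ => hB i j₁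
    have hC : 0 < Bᵀ.mulVec (fun _ => 1) j₁ + 1 := by linarith
    refine (ENNReal.ofReal_pos.mpr (div_pos (h j₀) hC)).trans_le (le_sInf ?_)
    rintro _ ⟨x, hx, hx0, rfl⟩
    refine le_sInf ?_
    rintro _ ⟨s, hs, rfl, hle⟩
    exact ENNReal.ofReal_le_ofReal (div_le_of_mulVec_le hC hj₀
      (fun j => (hj₁ j).trans (le_add_of_nonneg_right zero_le_one)) hx hx0 hs hle)
end

section
/- The weak Collatz–Wielandt quotient satisfies ρ̂(A,B) ≥ min_{j∈[n]} (∑_{i=1}^m a_{ij}) / (∑_{i=1}^m b_{ij}), where the quotient of column sums is interpreted with the conventions 0/0 = 0 and c/0 = ∞ for c > 0. -/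
open Matrix
open scoped ENNReal

/-- If `A x ≤ s B x` for some nonzero `x ≥ 0`, then some column sum of `A` is at most `s` times the
corresponding column sum of `B`. -/
theorem exists_col_sum_le_of_mulVec_le {m n : Type*} [Fintype m] [Fintype n]
    {A B : Matrix m n ℝ} {x : n → ℝ} {s : ℝ} (hx : ∀ j, 0 ≤ x j) (hx0 : x ≠ 0)
    (h : ∀ i, A.mulVec x i ≤ s * B.mulVec x i) :
    ∃ j, ∑ i, A i j ≤ s * ∑ i, B i j := by
  have sum_mulVec (M : Matrix m n ℝ) : ∑ i, M.mulVec x i = ∑ j, (∑ i, M i j) * x j := by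
    simp only [mulVec, dotProduct, Finset.sum_mul]
    exact Finset.sum_comm
  by_contra! hlt
  obtain ⟨k, hk⟩ := Function.ne_iff.mp hx0
  have hk_pos : 0 < x k := (hx k).lt_of_ne' hk
  have hsum : ∑ j, (s * ∑ i, B i j) * x j < ∑ j, (∑ i, A i j) * x j :=
    Finset.sum_lt_sum (fun j _ => mul_le_mul_of_nonneg_right (hlt j).le (hx j))
      ⟨k, Finset.mem_univ k, mul_lt_mul_of_pos_right (hlt k) hk_pos⟩
  refine hsum.not_ge ?_
  calc ∑ j, (∑ i, A i j) * x j = ∑ i, A.mulVec x i := (sum_mulVec A).symm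
    _ ≤ ∑ i, s * B.mulVec x i := Finset.sum_le_sum fun i _ => h i
    _ = ∑ j, (s * ∑ i, B i j) * x j := by
      rw [← Finset.mul_sum, sum_mulVec, Finset.mul_sum]
      simp only [mul_assoc]

/-- `ρ̂(A,B) ≥ min_j (∑ᵢ aᵢⱼ)/(∑ᵢ bᵢⱼ)`, where in `ℝ≥0∞` the conventions
`0/0 = 0` and `c/0 = ∞` (for `c > 0`) hold. -/
theorem stmt2 {m n : ℕ} (hm : 0 < m) (hn : 0 < n)
    (A B : Matrix (Fin m) (Fin n) ℝ)
    (hA : ∀ i j, 0 ≤ A i j) (hB : ∀ i j, 0 ≤ B i j) :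
    (⨅ j : Fin n, ENNReal.ofReal (∑ i, A i j) / ENNReal.ofReal (∑ i, B i j))
      ≤ cwRhoHat A B := by
  refine le_sInf ?_
  rintro _ ⟨x, hx, hx0, rfl⟩
  refine le_sInf ?_
  rintro _ ⟨s, hs, rfl, h⟩
  obtain ⟨j, hj⟩ := exists_col_sum_le_of_mulVec_le hx hx0 h
  refine (iInf_le _ j).trans (ENNReal.div_le_of_le_mul ?_)
  rw [← ENNReal.ofReal_mul hs]
  exact ENNReal.ofReal_le_ofReal hj
end

section
/- There exists a vector y ∈ ℝ_+^n with y ≠ 0 such that r(A,B,y) = ρ̂(A,B); that is, the infimum defining the weak Collatz–Wielandt quotient is attained. -/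
open Matrix
open scoped ENNReal

/-- If `x ≥ 0` and `cwR A B x ≤ s` with `s` finite, then `s` itself satisfies `A x ≤ s B x`. -/
theorem cwR_le_ofReal_iff {m n : ℕ} {A B : Matrix (Fin m) (Fin n) ℝ}
    (hB : ∀ i j, 0 ≤ B i j) {x : Fin n → ℝ} (hx : ∀ j, 0 ≤ x j) {s : ℝ} (hs : 0 ≤ s) :
    cwR A B x ≤ ENNReal.ofReal s ↔ ∀ i, A.mulVec x i ≤ s * B.mulVec x i := by
  refine ⟨fun h i => ?_, fun h => sInf_le ⟨s, hs, rfl, h⟩⟩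
  have hBx : 0 ≤ B.mulVec x i :=
    dotProduct_nonneg_of_nonneg (hB i) hx
  have hcont : Continuous fun u : ℝ => u * B.mulVec x i := by fun_prop
  refine ge_of_tendsto (hcont.continuousWithinAt (s := Set.Ioi s) (x := s)) ?_
  filter_upwards [self_mem_nhdsWithin] with u (hu : s < u)
  have hlt : cwR A B x < ENNReal.ofReal u :=
    h.trans_lt ((ENNReal.ofReal_lt_ofReal_iff (hs.trans_lt hu)).2 hu)
  obtain ⟨_, ⟨v, hv, rfl, hvx⟩, hvu⟩ := sInf_lt_iff.1 hlt
  have hvu' : v < u := (ENNReal.ofReal_lt_ofReal_iff_of_nonneg hv).1 hvu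
  exact (hvx i).trans (mul_le_mul_of_nonneg_right hvu'.le hBx)

theorem cwR_smul {m n : ℕ} (A B : Matrix (Fin m) (Fin n) ℝ) (x : Fin n → ℝ) {c : ℝ}
    (hc : 0 < c) : cwR A B (c • x) = cwR A B x := by
  simp only [cwR, Matrix.mulVec_smul, Pi.smul_apply, smul_eq_mul, mul_left_comm _ c,
    mul_le_mul_iff_right₀ hc]

theorem lowerSemicontinuousOn_cwR {m n : ℕ} (A : Matrix (Fin m) (Fin n) ℝ)
    {B : Matrix (Fin m) (Fin n) ℝ} (hB : ∀ i j, 0 ≤ B i j) :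
    LowerSemicontinuousOn (cwR A B) {x | ∀ j, 0 ≤ x j} := by
  intro x hx a ha
  obtain ⟨s, hs, rfl⟩ : ∃ s : ℝ, 0 ≤ s ∧ ENNReal.ofReal s = a :=
    ⟨a.toReal, ENNReal.toReal_nonneg, ENNReal.ofReal_toReal ha.ne_top⟩
  rw [gt_iff_lt, ← not_le, cwR_le_ofReal_iff hB hx hs] at ha
  push Not at ha
  obtain ⟨i, hi⟩ := ha
  have hopen : IsOpen {z : Fin n → ℝ | s * B.mulVec z i < A.mulVec z i} :=
    isOpen_lt (by fun_prop) (by fun_prop)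
  filter_upwards [mem_nhdsWithin_of_mem_nhds (hopen.mem_nhds hi), self_mem_nhdsWithin]
    with z hz hz0
  rw [gt_iff_lt, ← not_le, cwR_le_ofReal_iff hB hz0 hs]
  exact fun h => (h i).not_gt hz

/-- The infimum defining the weak Collatz–Wielandt quotient is attained. -/
theorem stmt4 {m n : ℕ} (hm : 0 < m) (hn : 0 < n)
    (A B : Matrix (Fin m) (Fin n) ℝ)
    (hA : ∀ i j, 0 ≤ A i j) (hB : ∀ i j, 0 ≤ B i j) :
    ∃ y : Fin n → ℝ, (∀ j, 0 ≤ y j) ∧ y ≠ 0 ∧ cwR A B y = cwRhoHat A B := by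
  have hne : (stdSimplex ℝ (Fin n)).Nonempty := ⟨_, single_mem_stdSimplex ℝ ⟨0, hn⟩⟩
  obtain ⟨y, hy, hmin⟩ := LowerSemicontinuousOn.exists_isMinOn hne (isCompact_stdSimplex ℝ (Fin n))
    ((lowerSemicontinuousOn_cwR A hB).mono fun x hx => hx.1)
  have hy0 : y ≠ 0 := by
    rintro rfl
    simpa using hy.2
  refine ⟨y, hy.1, hy0, le_antisymm (le_sInf ?_) (sInf_le ⟨y, hy.1, hy0, rfl⟩)⟩
  rintro _ ⟨x, hx, hx0, rfl⟩
  have hsum : 0 < ∑ j, x j := Fintype.sum_pos (lt_of_le_of_ne hx hx0.symm)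
  rw [← cwR_smul A B x (inv_pos.2 hsum)]
  refine hmin ⟨fun j => mul_nonneg (inv_pos.2 hsum).le (hx j), ?_⟩
  simp only [Pi.smul_apply, smul_eq_mul, ← Finset.mul_sum]
  exact inv_mul_cancel₀ hsum.ne'
end

section
/- There exists a vector y ∈ ℝ_+^n with y ≠ 0 such that r(A,B,y) = ρ(A,B), together with a sequence of entrywise positive vectors y_k ∈ ℝ^n (k ∈ ℕ) such that y_k → y and r(A,B,y_k) → ρ(A,B) as k → ∞. -/
open Matrix Filter
open scoped ENNReal Topology

/-- The Collatz–Wielandt quotient `ρ(A,B) = inf{r(A,B,x) : x > 0 entrywise}`. -/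
noncomputable def cwRho {m n : ℕ} (A B : Matrix (Fin m) (Fin n) ℝ) : ℝ≥0∞ :=
  sInf {t : ℝ≥0∞ | ∃ x : Fin n → ℝ, (∀ j, 0 < x j) ∧ t = cwR A B x}

theorem cwR_le_ofReal {m n : ℕ} {A B : Matrix (Fin m) (Fin n) ℝ} {x : Fin n → ℝ} {s : ℝ}
    (hs : 0 ≤ s) (h : ∀ i, A.mulVec x i ≤ s * B.mulVec x i) : cwR A B x ≤ ENNReal.ofReal s :=
  sInf_le ⟨s, hs, rfl, h⟩

theorem exists_lt_of_cwR_lt {m n : ℕ} {A B : Matrix (Fin m) (Fin n) ℝ} {x : Fin n → ℝ} {r : ℝ}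
    (h : cwR A B x < ENNReal.ofReal r) :
    ∃ s, 0 ≤ s ∧ s < r ∧ ∀ i, A.mulVec x i ≤ s * B.mulVec x i := by
  obtain ⟨_, ⟨s, hs, rfl, hx⟩, hlt⟩ := sInf_lt_iff.1 h
  exact ⟨s, hs, (ENNReal.ofReal_lt_ofReal_iff_of_nonneg hs).1 hlt, hx⟩

theorem cwRho_le_cwR {m n : ℕ} (A B : Matrix (Fin m) (Fin n) ℝ) {x : Fin n → ℝ}
    (hx : ∀ j, 0 < x j) : cwRho A B ≤ cwR A B x :=
  sInf_le ⟨x, hx, rfl⟩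

theorem exists_pos_of_cwRho_lt {m n : ℕ} {A B : Matrix (Fin m) (Fin n) ℝ} {r : ℝ}
    (h : cwRho A B < ENNReal.ofReal r) :
    ∃ x : Fin n → ℝ, (∀ j, 0 < x j) ∧ ∃ s, 0 ≤ s ∧ s < r ∧
      ∀ i, A.mulVec x i ≤ s * B.mulVec x i := by
  obtain ⟨_, ⟨x, hx, rfl⟩, hlt⟩ := sInf_lt_iff.1 h
  exact ⟨x, hx, exists_lt_of_cwR_lt hlt⟩

theorem mulVec_apply_nonneg {m n : ℕ} {C : Matrix (Fin m) (Fin n) ℝ} (hC : ∀ i j, 0 ≤ C i j)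
    {x : Fin n → ℝ} (hx : ∀ j, 0 ≤ x j) (i : Fin m) : 0 ≤ C.mulVec x i := by
  simp only [mulVec, dotProduct]
  exact Finset.sum_nonneg fun j _ => mul_nonneg (hC i j) (hx j)

/-- If row `i` of `C` annihilates `y ≥ 0`, it only sees the coordinates outside the support
of `y`. -/
theorem mulVec_apply_eq_of_agree_off_support {m n : ℕ} {C : Matrix (Fin m) (Fin n) ℝ}
    (hC : ∀ i j, 0 ≤ C i j) {y : Fin n → ℝ} (hy : ∀ j, 0 ≤ y j) {i : Fin m}
    (hi : C.mulVec y i = 0) {u v : Fin n → ℝ} (huv : ∀ j, y j = 0 → u j = v j) :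
    C.mulVec u i = C.mulVec v i := by
  simp only [mulVec, dotProduct] at hi ⊢
  have h0 := (Finset.sum_eq_zero_iff_of_nonneg
    (fun j _ => mul_nonneg (hC i j) (hy j))).1 hi
  refine Finset.sum_congr rfl fun j hj => ?_
  rcases mul_eq_zero.1 (h0 j hj) with h | h
  · simp [h]
  · rw [huv j h]

/-- A vector of maximal support among `0` and the nonnegative vectors of ratio less than `r`. -/
theorem exists_maximal_support {m n : ℕ} (A B : Matrix (Fin m) (Fin n) ℝ) (r : ℝ) :
    ∃ y : Fin n → ℝ, (∀ j, 0 ≤ y j) ∧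
      (y = 0 ∨ ∃ s, 0 ≤ s ∧ s < r ∧ ∀ i, A.mulVec y i ≤ s * B.mulVec y i) ∧
      ∀ w : Fin n → ℝ, (∀ j, 0 ≤ w j) → (∀ j, w j = 0 → y j = 0) → (∃ j, y j = 0 ∧ w j ≠ 0) →
        ¬ ∃ s, 0 ≤ s ∧ s < r ∧ ∀ i, A.mulVec w i ≤ s * B.mulVec w i := by
  classical
  obtain ⟨y, ⟨hy0, hy⟩, hmin⟩ := (measure fun y : Fin n → ℝ =>
      (Finset.univ.filter fun j => y j = 0).card).wf.has_min
    {y | (∀ j, 0 ≤ y j) ∧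
      (y = 0 ∨ ∃ s, 0 ≤ s ∧ s < r ∧ ∀ i, A.mulVec y i ≤ s * B.mulVec y i)}
    ⟨0, fun _ => le_rfl, Or.inl rfl⟩
  refine ⟨y, hy0, hy, fun w hw hsub ⟨j, hyj, hwj⟩ hr => hmin w ⟨hw, Or.inr hr⟩ ?_⟩
  refine Finset.card_lt_card (Finset.ssubset_iff_subset_ne.2 ⟨fun k hk => ?_, fun h => ?_⟩)
  · simp only [Finset.mem_filter, Finset.mem_univ, true_and] at hk ⊢
    exact hsub k hk
  · have : j ∈ Finset.univ.filter fun j => w j = 0 := by simp [h, hyj]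
    exact hwj (by simpa using this)

/-- Rows on which `B y` is positive tolerate every perturbation `z ∈ [0,1]^n` of a large
multiple of `y`. -/
theorem exists_scale {m n : ℕ} {A B : Matrix (Fin m) (Fin n) ℝ}
    (hA : ∀ i j, 0 ≤ A i j) (hB : ∀ i j, 0 ≤ B i j) {y : Fin n → ℝ} {s r : ℝ}
    (hr : 0 ≤ r) (hsr : s < r) (h : ∀ i, A.mulVec y i ≤ s * B.mulVec y i) :
    ∃ M : ℝ, 0 < M ∧ ∀ i, 0 < B.mulVec y i → ∀ z : Fin n → ℝ, (∀ j, 0 ≤ z j) →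
      (∀ j, z j ≤ 1) → A.mulVec (z + M • y) i ≤ r * B.mulVec (z + M • y) i := by
  have hev : ∀ᶠ M : ℝ in atTop, ∀ i, 0 < B.mulVec y i →
      ∑ j, A i j ≤ M * ((r - s) * B.mulVec y i) := by
    refine eventually_all.2 fun i => ?_
    by_cases hi : 0 < B.mulVec y i
    · filter_upwards [(tendsto_id.atTop_mul_const (mul_pos (sub_pos.2 hsr) hi)).eventually_ge_atTop
        (∑ j, A i j)] with M hM _ using hM
    · exact Eventually.of_forall fun M h => absurd h hi
  obtain ⟨M, hM, hM0⟩ := (hev.and (eventually_gt_atTop 0)).exists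
  refine ⟨M, hM0, fun i hi z hz0 hz1 => ?_⟩
  have hAz : A.mulVec z i ≤ ∑ j, A i j := by
    simp only [mulVec, dotProduct]
    exact Finset.sum_le_sum fun j _ => mul_le_of_le_one_right (hA i j) (hz1 j)
  have hBz := mul_nonneg hr (mulVec_apply_nonneg hB hz0 i)
  have hMy := mul_le_mul_of_nonneg_left (h i) hM0.le
  simp only [mulVec_add, mulVec_smul, Pi.add_apply, Pi.smul_apply, smul_eq_mul]
  linarith [hM i hi]

/-- Positive vectors of ratio at most `t`, normalised off the support of `y`. -/
theorem exists_normalized {m n : ℕ} {A B : Matrix (Fin m) (Fin n) ℝ}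
    (hA : ∀ i j, 0 ≤ A i j) (hB : ∀ i j, 0 ≤ B i j) {y x : Fin n → ℝ} (hy : ∀ j, 0 ≤ y j)
    {j₀ : Fin n} (hj₀ : y j₀ = 0) (hx : ∀ j, 0 < x j) {t : ℝ}
    (h : ∀ i, A.mulVec x i ≤ t * B.mulVec x i) :
    ∃ z : Fin n → ℝ, z ∈ Set.Icc 0 1 ∧ (∀ j, y j = 0 → 0 < z j) ∧ (∀ j, y j ≠ 0 → z j = 0) ∧
      ∑ j, z j = 1 ∧ ∀ i, A.mulVec y i = 0 → B.mulVec y i = 0 →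
        A.mulVec z i ≤ t * B.mulVec z i := by
  classical
  let v : Fin n → ℝ := fun j => if y j = 0 then x j else 0
  have hv0 : ∀ j, 0 ≤ v j := fun j => by
    by_cases hj : y j = 0 <;> simp [v, hj, (hx j).le]
  have hS : 0 < ∑ j, v j :=
    Finset.sum_pos' (fun j _ => hv0 j) ⟨j₀, Finset.mem_univ _, by simp [v, hj₀, hx j₀]⟩
  have hc : 0 < (∑ j, v j)⁻¹ := inv_pos.2 hS
  refine ⟨(∑ j, v j)⁻¹ • v, ⟨fun j => mul_nonneg hc.le (hv0 j), fun j => ?_⟩, fun j hj => ?_,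
    fun j hj => by simp [v, hj], ?_, fun i hAi hBi => ?_⟩
  · have := Finset.single_le_sum (fun j _ => hv0 j) (Finset.mem_univ j)
    simpa [inv_mul_eq_div] using (div_le_one hS).2 this
  · have : v j = x j := by simp [v, hj]
    simpa [this] using mul_pos hc (hx j)
  · simp only [Pi.smul_apply, smul_eq_mul, ← Finset.mul_sum]
    exact inv_mul_cancel₀ hS.ne'
  · have huv : ∀ j, y j = 0 → v j = x j := fun j hj => by simp [v, hj]
    simp only [mulVec_smul, Pi.smul_apply, smul_eq_mul,
      mulVec_apply_eq_of_agree_off_support hA hy hAi huv,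
      mulVec_apply_eq_of_agree_off_support hB hy hBi huv]
    have := mul_le_mul_of_nonneg_left (h i) hc.le
    linarith

/-- There is an optimal vector `y` for `ρ(A,B)`: `r(A,B,y) = ρ(A,B)` and `y` is a
limit of positive vectors `y_k` with `r(A,B,y_k) → ρ(A,B)`. -/
theorem stmt5 {m n : ℕ} (hm : 0 < m) (hn : 0 < n)
    (A B : Matrix (Fin m) (Fin n) ℝ)
    (hA : ∀ i j, 0 ≤ A i j) (hB : ∀ i j, 0 ≤ B i j) :
    ∃ y : Fin n → ℝ, (∀ j, 0 ≤ y j) ∧ y ≠ 0 ∧ cwR A B y = cwRho A B ∧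
      ∃ yk : ℕ → Fin n → ℝ, (∀ k j, 0 < yk k j) ∧
        Tendsto yk atTop (𝓝 y) ∧
        Tendsto (fun k => cwR A B (yk k)) atTop (𝓝 (cwRho A B)) := by
  by_cases htop : cwRho A B = ⊤
  · have hone : cwR A B 1 = cwRho A B :=
      (le_top.trans_eq htop.symm).antisymm (cwRho_le_cwR A B fun _ => one_pos)
    refine ⟨1, fun _ => zero_le_one, fun h => one_ne_zero (congrFun h ⟨0, hn⟩), hone,
      fun _ => 1, fun _ _ => one_pos, tendsto_const_nhds, ?_⟩
    simp only [hone, tendsto_const_nhds]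
  obtain ⟨r, hr0, hr⟩ : ∃ r : ℝ, 0 ≤ r ∧ cwRho A B = ENNReal.ofReal r :=
    ⟨_, ENNReal.toReal_nonneg, (ENNReal.ofReal_toReal htop).symm⟩
  obtain ⟨y, hy0, hy, hmax⟩ := exists_maximal_support A B r
  obtain ⟨j₀, hj₀⟩ : ∃ j, y j = 0 := by
    by_contra! hne
    rcases hy with rfl | ⟨s, hs0, hsr, hs⟩
    · exact hne ⟨0, hn⟩ rfl
    · have h1 := (cwRho_le_cwR A B fun j => (hy0 j).lt_of_ne (hne j).symm).trans
        (cwR_le_ofReal hs0 hs)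
      rw [hr, ENNReal.ofReal_le_ofReal_iff hs0] at h1
      exact hsr.not_ge h1
  obtain ⟨s, hsr, hs⟩ : ∃ s, s < r ∧ ∀ i, A.mulVec y i ≤ s * B.mulVec y i := by
    rcases hy with rfl | ⟨s, -, hsr, hs⟩
    · exact ⟨r - 1, by linarith, by simp⟩
    · exact ⟨s, hsr, hs⟩
  obtain ⟨M, hM0, hM⟩ := exists_scale hA hB hr0 hsr hs
  have hz : ∀ k : ℕ, ∃ z : Fin n → ℝ, z ∈ Set.Icc 0 1 ∧ (∀ j, 0 < (z + M • y) j) ∧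
      (∑ j, if y j = 0 then z j else 0) = 1 ∧
      ∀ i, A.mulVec (z + M • y) i ≤ (r + 1 / ((k : ℝ) + 1)) * B.mulVec (z + M • y) i := by
    intro k
    have hk : 0 < 1 / ((k : ℝ) + 1) := by positivity
    obtain ⟨x, hx, t, -, htk, hxt⟩ := exists_pos_of_cwRho_lt (A := A) (B := B)
      (r := r + 1 / ((k : ℝ) + 1))
      (by rw [hr, ENNReal.ofReal_lt_ofReal_iff_of_nonneg hr0]; linarith)
    obtain ⟨z, hz01, hzpos, hzz, hzsum, hzt⟩ := exists_normalized hA hB hy0 hj₀ hx hxt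
    have hw : ∀ j, 0 < (z + M • y) j := fun j => by
      by_cases hj : y j = 0
      · simpa [hj] using hzpos j hj
      · simpa [hzz j hj] using mul_pos hM0 ((hy0 j).lt_of_ne' hj)
    refine ⟨z, hz01, hw, ?_, fun i => ?_⟩
    · rw [← hzsum]
      refine Finset.sum_congr rfl fun j _ => ?_
      split_ifs with hj
      · rfl
      · exact (hzz j hj).symm
    · have hBw := mulVec_apply_nonneg hB (fun j => (hw j).le) i
      rcases (mulVec_apply_nonneg hB hy0 i).eq_or_lt' with hi | hi
      · have hAi : A.mulVec y i = 0 :=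
          le_antisymm (by simpa [hi] using hs i) (mulVec_apply_nonneg hA hy0 i)
        refine le_trans ?_ (mul_le_mul_of_nonneg_right htk.le hBw)
        simpa [mulVec_add, mulVec_smul, hi, hAi] using hzt i hAi hi
      · exact (hM i hi z hz01.1 hz01.2).trans
          (mul_le_mul_of_nonneg_right (by linarith) hBw)
  choose z hz01 hzpos hzsum hzr using hz
  obtain ⟨ζ, hζ, φ, hφ, hlim⟩ := isCompact_Icc.tendsto_subseq hz01
  have hwlim : Tendsto (fun k => z (φ k) + M • y) atTop (𝓝 (ζ + M • y)) :=
    hlim.add_const (M • y)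
  have hrlim : Tendsto (fun k => r + 1 / ((φ k : ℝ) + 1)) atTop (𝓝 r) := by
    simpa using (tendsto_one_div_add_atTop_nhds_zero_nat.comp hφ.tendsto_atTop).const_add r
  have hcont : ∀ (C : Matrix (Fin m) (Fin n) ℝ) i,
      Tendsto (fun k => C.mulVec (z (φ k) + M • y) i) atTop (𝓝 (C.mulVec (ζ + M • y) i)) :=
    fun C i => (((continuous_apply i).comp
      (Continuous.matrix_mulVec continuous_const continuous_id)).tendsto _).comp hwlim
  have hwr : ∀ i, A.mulVec (ζ + M • y) i ≤ r * B.mulVec (ζ + M • y) i := fun i =>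
    le_of_tendsto_of_tendsto' (hcont A i) (hrlim.mul (hcont B i)) fun k => hzr (φ k) i
  have hw0 : ∀ j, 0 ≤ (ζ + M • y) j := fun j =>
    add_nonneg (hζ.1 j) (mul_nonneg hM0.le (hy0 j))
  have hζsum : (∑ j, if y j = 0 then ζ j else 0) = 1 := by
    refine tendsto_nhds_unique (l := atTop) (f := fun k => ∑ j, if y j = 0 then z (φ k) j else 0)
      (tendsto_finsetSum _ fun j _ => ?_) (by simp only [hzsum, tendsto_const_nhds])
    split_ifs
    · exact (tendsto_pi_nhds.1 hlim) j
    · exact tendsto_const_nhds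
  obtain ⟨j₁, hyj₁, hζj₁⟩ : ∃ j, y j = 0 ∧ ζ j ≠ 0 := by
    by_contra! hne
    rw [Finset.sum_eq_zero fun j _ => by split_ifs with hj; exacts [hne j hj, rfl]] at hζsum
    exact zero_ne_one hζsum
  have hwj₁ : (ζ + M • y) j₁ ≠ 0 := by simpa [hyj₁] using hζj₁
  refine ⟨ζ + M • y, hw0, fun h => hwj₁ (congrFun h j₁), ?_, fun k => z (φ k) + M • y,
    fun k => hzpos (φ k), hwlim, ?_⟩
  · rw [hr]
    refine (cwR_le_ofReal hr0 hwr).antisymm (not_lt.1 fun hlt => ?_)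
    refine hmax _ hw0 (fun j hj => ?_) ⟨j₁, hyj₁, hwj₁⟩ (exists_lt_of_cwR_lt hlt)
    have hζj : 0 ≤ ζ j := hζ.1 j
    have hMyj : 0 ≤ M * y j := mul_nonneg hM0.le (hy0 j)
    simp only [Pi.add_apply, Pi.smul_apply, smul_eq_mul] at hj
    have hMy : M * y j = 0 := by linarith
    exact (mul_eq_zero.1 hMy).resolve_left hM0.ne'
  · have hup : Tendsto (fun k => ENNReal.ofReal (r + 1 / ((φ k : ℝ) + 1))) atTop
        (𝓝 (cwRho A B)) := hr ▸ ENNReal.tendsto_ofReal hrlim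
    exact tendsto_of_tendsto_of_tendsto_of_le_of_le tendsto_const_nhds hup
      (fun k => cwRho_le_cwR A B (hzpos (φ k)))
      (fun k => cwR_le_ofReal (by positivity) (hzr (φ k)))
end

section
/- Let y ∈ ℝ_+^n, y ≠ 0, be weakly optimal, i.e., r(A,B,y) = ρ̂(A,B). If either A y > 0 entrywise or B y > 0 entrywise, then ρ(A,B) = ρ̂(A,B). -/
open Matrix
open scoped ENNReal

theorem cwRhoHat_le_cwRho {m n : ℕ} (hn : 0 < n) (A B : Matrix (Fin m) (Fin n) ℝ) :
    cwRhoHat A B ≤ cwRho A B := by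
  refine sInf_le_sInf ?_
  rintro t ⟨x, hx, rfl⟩
  exact ⟨x, fun j => (hx j).le, fun h => (hx ⟨0, hn⟩).ne' (congrFun h _), rfl⟩

theorem cwRho_le_ofReal {m n : ℕ} {A B : Matrix (Fin m) (Fin n) ℝ} {x : Fin n → ℝ}
    (hx : ∀ j, 0 < x j) {s : ℝ} (hs : 0 ≤ s)
    (h : ∀ i, A.mulVec x i ≤ s * B.mulVec x i) : cwRho A B ≤ ENNReal.ofReal s :=
  (sInf_le ⟨x, hx, rfl⟩ : cwRho A B ≤ cwR A B x).trans (sInf_le ⟨s, hs, rfl, h⟩)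

/-- A strict inequality at a nonnegative vector persists at a nearby positive vector. -/
theorem exists_pos_mulVec_le_of_lt {m n : ℕ} {A B : Matrix (Fin m) (Fin n) ℝ} {y : Fin n → ℝ}
    (hy : ∀ j, 0 ≤ y j) {s : ℝ} (h : ∀ i, A.mulVec y i < s * B.mulVec y i) :
    ∃ x : Fin n → ℝ, (∀ j, 0 < x j) ∧ ∀ i, A.mulVec x i ≤ s * B.mulVec x i := by
  have key : ∀ᶠ ε in nhdsWithin (0 : ℝ) (Set.Ioi 0), ∀ i,
      A.mulVec (y + ε • 1) i < s * B.mulVec (y + ε • 1) i := by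
    refine Filter.eventually_all.2 fun i => Filter.Eventually.filter_mono nhdsWithin_le_nhds ?_
    simp only [mulVec_add, mulVec_smul, Pi.add_apply, Pi.smul_apply, smul_eq_mul]
    refine ContinuousAt.eventually_lt (by fun_prop) (by fun_prop) ?_
    simpa using h i
  obtain ⟨ε, hε, hpos⟩ := (key.and self_mem_nhdsWithin).exists
  refine ⟨y + ε • 1, fun j => ?_, fun i => (hε i).le⟩
  simpa using add_pos_of_nonneg_of_pos (hy j) hpos

/-- If a weakly optimal `y` satisfies `A y > 0` or `B y > 0` entrywise,
then `ρ(A,B) = ρ̂(A,B)`. -/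
theorem stmt6 {m n : ℕ} (hm : 0 < m) (hn : 0 < n)
    (A B : Matrix (Fin m) (Fin n) ℝ)
    (hA : ∀ i j, 0 ≤ A i j) (hB : ∀ i j, 0 ≤ B i j)
    (y : Fin n → ℝ) (hy0 : ∀ j, 0 ≤ y j) (hyne : y ≠ 0)
    (hopt : cwR A B y = cwRhoHat A B)
    (hpos : (∀ i, 0 < A.mulVec y i) ∨ (∀ i, 0 < B.mulVec y i)) :
    cwRho A B = cwRhoHat A B := by
  refine le_antisymm ?_ (cwRhoHat_le_cwRho hn A B)
  rw [← hopt]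
  refine le_sInf ?_
  rintro t ⟨s, hs, rfl, hle⟩
  have hBy : ∀ i, 0 < B.mulVec y i := fun i =>
    hpos.elim (fun h => pos_of_mul_pos_right ((h i).trans_le (hle i)) hs) (fun h => h i)
  refine ENNReal.le_of_forall_pos_le_add fun δ hδ _ => ?_
  have hδ' : (0 : ℝ) < δ := hδ
  obtain ⟨x, hx, hxle⟩ := exists_pos_mulVec_le_of_lt (A := A) (B := B) (s := s + δ) hy0
    fun i => (hle i).trans_lt (mul_lt_mul_of_pos_right (lt_add_of_pos_right s hδ') (hBy i))
  have hρ := cwRho_le_ofReal hx (by positivity) hxle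
  rwa [ENNReal.ofReal_add hs hδ'.le, ENNReal.ofReal_coe_nnreal] at hρ
end

section
/- Assume ρ̂(A,B) < ∞ and let y ∈ ℝ_+^n, y ≠ 0, be weakly optimal, i.e., r(A,B,y) = ρ̂(A,B). Then at least one coordinate of the vector (A − ρ̂(A,B)·B) y is zero. -/
open Matrix
open scoped ENNReal

/-- A finite value of `cwR A B x` is attained: it satisfies the defining inequality. -/
theorem mulVec_le_toReal_cwR_mul {m n : ℕ} {A B : Matrix (Fin m) (Fin n) ℝ} {x : Fin n → ℝ}
    (hfin : cwR A B x < ⊤) (hBx : ∀ i, 0 ≤ B.mulVec x i) (i : Fin m) :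
    A.mulVec x i ≤ (cwR A B x).toReal * B.mulVec x i := by
  have hlim : Filter.Tendsto (fun s : ℝ => s * B.mulVec x i)
      (nhdsWithin (cwR A B x).toReal (Set.Ioi (cwR A B x).toReal))
      (nhds ((cwR A B x).toReal * B.mulVec x i)) :=
    (continuous_id.mul continuous_const).continuousAt.tendsto.mono_left nhdsWithin_le_nhds
  refine ge_of_tendsto hlim ?_
  filter_upwards [self_mem_nhdsWithin] with s hs
  have hlt : cwR A B x < ENNReal.ofReal s :=
    (ENNReal.lt_ofReal_iff_toReal_lt hfin.ne).2 hs
  obtain ⟨_, ⟨t, ht, rfl, hle⟩, hts⟩ := sInf_lt_iff.1 hlt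
  have hts : t ≤ s := ((ENNReal.ofReal_lt_ofReal_iff_of_nonneg ht).1 hts).le
  exact (hle i).trans (mul_le_mul_of_nonneg_right hts (hBx i))

/-- If `s ≥ 0` satisfies `A x ≤ s B x` entrywise, then `cwR A B x` is at most `s`. -/
theorem toReal_cwR_le {m n : ℕ} {A B : Matrix (Fin m) (Fin n) ℝ} {x : Fin n → ℝ} {s : ℝ}
    (hs : 0 ≤ s) (h : ∀ i, A.mulVec x i ≤ s * B.mulVec x i) :
    (cwR A B x).toReal ≤ s :=
  ENNReal.toReal_le_of_le_ofReal hs (sInf_le ⟨s, hs, rfl, h⟩)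

/-- If `ρ̂(A,B) < ∞` and `y` is weakly optimal, then some coordinate of
`(A - ρ̂(A,B) B) y` vanishes. -/
theorem stmt11 {m n : ℕ} (hm : 0 < m) (hn : 0 < n)
    (A B : Matrix (Fin m) (Fin n) ℝ)
    (hA : ∀ i j, 0 ≤ A i j) (hB : ∀ i j, 0 ≤ B i j)
    (hfin : cwRhoHat A B < ⊤)
    (y : Fin n → ℝ) (hy0 : ∀ j, 0 ≤ y j) (hyne : y ≠ 0)
    (hopt : cwR A B y = cwRhoHat A B) :
    ∃ i, A.mulVec y i - (cwRhoHat A B).toReal * B.mulVec y i = 0 := by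
  rw [← hopt] at hfin ⊢
  have hAy : ∀ i, 0 ≤ A.mulVec y i := fun i =>
    dotProduct_nonneg_of_nonneg (hA i) hy0
  have hBy : ∀ i, 0 ≤ B.mulVec y i := fun i =>
    dotProduct_nonneg_of_nonneg (hB i) hy0
  by_contra! hne
  have hlt : ∀ i, A.mulVec y i < (cwR A B y).toReal * B.mulVec y i := fun i =>
    (mulVec_le_toReal_cwR_mul hfin hBy i).lt_of_ne (sub_ne_zero.1 (hne i))
  have hBpos : ∀ i, 0 < B.mulVec y i := fun i =>
    pos_of_mul_pos_right ((hAy i).trans_lt (hlt i)) ENNReal.toReal_nonneg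
  have : Nonempty (Fin m) := ⟨⟨0, hm⟩⟩
  obtain ⟨k, hk⟩ := Finite.exists_max fun i => A.mulVec y i / B.mulVec y i
  exact ((div_lt_iff₀ (hBpos k)).2 (hlt k)).not_ge <|
    toReal_cwR_le (div_nonneg (hAy k) (hBy k)) fun i => (div_le_iff₀ (hBpos i)).1 (hk i)
end

section
/- Let 0 < b < a < 1/2 and set A = [[a, 1−a], [b, 1−b]] and B = [[1−a, a], [1−b, b]]. Then ρ(A,B) = ρ̂(A,B) = a/(1−a) < 1, the vector z = (1,0)ᵀ is the unique optimal vector among probability vectors in ℝ_+^2, and z is not a generalized Perron–Frobenius eigenvector (i.e., A z ≠ ρ(A,B) B z). -/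
open Matrix Filter
open scoped ENNReal Topology

/-- `y` is optimal for the pair `(A,B)`: `r(A,B,y) = ρ(A,B)` and `y` is a limit of
entrywise positive vectors `y_k` with `r(A,B,y_k) → ρ(A,B)`. -/
def OptimalVec {m n : ℕ} (A B : Matrix (Fin m) (Fin n) ℝ) (y : Fin n → ℝ) : Prop :=
  (∀ j, 0 ≤ y j) ∧ y ≠ 0 ∧ cwR A B y = cwRho A B ∧
  ∃ yk : ℕ → Fin n → ℝ, (∀ k j, 0 < yk k j) ∧
    Tendsto yk atTop (𝓝 y) ∧
    Tendsto (fun k => cwR A B (yk k)) atTop (𝓝 (cwRho A B))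

theorem ofReal_firstRow_div_le_cwR {a b : ℝ} {x : Fin 2 → ℝ}
    (hx : 0 < (1 - a) * x 0 + a * x 1) :
    ENNReal.ofReal ((a * x 0 + (1 - a) * x 1) / ((1 - a) * x 0 + a * x 1)) ≤
      cwR !![a, 1 - a; b, 1 - b] !![1 - a, a; 1 - b, b] x := by
  refine le_sInf ?_
  rintro _ ⟨s, -, rfl, h⟩
  refine ENNReal.ofReal_le_ofReal ((div_le_iff₀ hx).2 ?_)
  simpa [Matrix.mulVec, dotProduct, Fin.sum_univ_two] using h 0

theorem cwR_eq_ofReal_firstRow_div {a b : ℝ} (hb : 0 < b) (hba : b < a) (ha : a < 1 / 2)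
    {x : Fin 2 → ℝ} (h0 : 0 < x 0) (h1 : 0 ≤ x 1) (h10 : x 1 ≤ x 0) :
    cwR !![a, 1 - a; b, 1 - b] !![1 - a, a; 1 - b, b] x =
      ENNReal.ofReal ((a * x 0 + (1 - a) * x 1) / ((1 - a) * x 0 + a * x 1)) := by
  have ha0 : 0 < a := hb.trans hba
  have ha1 : 0 < 1 - a := by linarith
  have hx : 0 < (1 - a) * x 0 + a * x 1 := by positivity
  refine le_antisymm (sInf_le ⟨_, by positivity, rfl, ?_⟩) (ofReal_firstRow_div_le_cwR hx)
  simp only [Fin.forall_fin_two, Matrix.mulVec, dotProduct, Fin.sum_univ_two]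
  refine ⟨?_, ?_⟩
  · simp [div_mul_cancel₀ _ hx.ne']
  · rw [div_mul_eq_mul_div, le_div_iff₀ hx]
    simp
    nlinarith [mul_nonneg (sub_nonneg.2 hba.le)
      (mul_nonneg (sub_nonneg.2 h10) (add_nonneg h0.le h1))]

theorem firstRow_div_ge {a p q : ℝ} (ha : 0 < a) (ha' : a < 1 / 2) (hq : 0 ≤ q)
    (h : 0 < (1 - a) * p + a * q) :
    a / (1 - a) ≤ (a * p + (1 - a) * q) / ((1 - a) * p + a * q) := by
  rw [div_le_div_iff₀ (by linarith) h]
  nlinarith [mul_nonneg hq (by linarith : 0 ≤ 1 - 2 * a)]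

theorem firstRow_pos {a : ℝ} (ha : 0 < a) (ha' : a < 1) {x : Fin 2 → ℝ}
    (hx : ∀ j, 0 ≤ x j) (hne : x ≠ 0) : 0 < (1 - a) * x 0 + a * x 1 := by
  have ha1 : 0 < 1 - a := by linarith
  rcases (hx 0).lt_or_eq with h | h
  · have := hx 1
    positivity
  · have h1 : x 1 ≠ 0 := fun h1 => hne (by ext j; fin_cases j <;> simp [← h, h1])
    have := (hx 1).lt_of_ne' h1
    rw [← h]
    simpa using mul_pos ha this

theorem ofReal_div_le_cwR {a b : ℝ} (ha : 0 < a) (ha' : a < 1 / 2) {x : Fin 2 → ℝ}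
    (hx : ∀ j, 0 ≤ x j) (hne : x ≠ 0) :
    ENNReal.ofReal (a / (1 - a)) ≤ cwR !![a, 1 - a; b, 1 - b] !![1 - a, a; 1 - b, b] x := by
  have h := firstRow_pos ha (by linarith) hx hne
  exact (ENNReal.ofReal_le_ofReal (firstRow_div_ge ha ha' (hx 1) h)).trans
    (ofReal_firstRow_div_le_cwR h)

theorem tendsto_cwR_one_inv {a b : ℝ} (hb : 0 < b) (hba : b < a) (ha : a < 1 / 2) :
    Tendsto (fun k : ℕ => cwR !![a, 1 - a; b, 1 - b] !![1 - a, a; 1 - b, b]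
      ![1, 1 / ((k : ℝ) + 1)]) atTop (𝓝 (ENNReal.ofReal (a / (1 - a)))) := by
  have hval : ∀ k : ℕ, cwR !![a, 1 - a; b, 1 - b] !![1 - a, a; 1 - b, b]
      ![1, 1 / ((k : ℝ) + 1)] = ENNReal.ofReal ((a * 1 + (1 - a) * (1 / ((k : ℝ) + 1))) /
        ((1 - a) * 1 + a * (1 / ((k : ℝ) + 1)))) := fun k =>
    cwR_eq_ofReal_firstRow_div hb hba ha (x := ![1, 1 / ((k : ℝ) + 1)])
      one_pos (by simp; positivity)
      (by
        have hk : (0 : ℝ) ≤ k := k.cast_nonneg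
        change 1 / ((k : ℝ) + 1) ≤ 1
        rw [div_le_one (by positivity)]
        linarith)
  simp_rw [hval]
  refine ENNReal.tendsto_ofReal ?_
  have ht : Tendsto (fun k : ℕ => 1 / ((k : ℝ) + 1)) atTop (𝓝 0) :=
    tendsto_one_div_add_atTop_nhds_zero_nat
  have := ((ht.const_mul (1 - a)).const_add (a * 1)).div
    ((ht.const_mul a).const_add ((1 - a) * 1)) (by simp; linarith)
  simpa [Pi.div_def] using this

/-- For `0 < b < a < 1/2`, `A = [[a,1-a],[b,1-b]]`, `B = [[1-a,a],[1-b,b]]`: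
`ρ(A,B) = ρ̂(A,B) = a/(1-a) < 1`, the vector `(1,0)ᵀ` is the unique optimal
probability vector, and it is not a GPF-eigenvector. -/
theorem stmt15 (a b : ℝ) (hb : 0 < b) (hba : b < a) (ha : a < 1/2)
    (A B : Matrix (Fin 2) (Fin 2) ℝ)
    (hAdef : A = !![a, 1-a; b, 1-b]) (hBdef : B = !![1-a, a; 1-b, b]) :
    cwRho A B = ENNReal.ofReal (a/(1-a)) ∧
    cwRhoHat A B = ENNReal.ofReal (a/(1-a)) ∧
    a/(1-a) < 1 ∧
    OptimalVec A B ![1, 0] ∧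
    (∀ y : Fin 2 → ℝ, (∀ j, 0 ≤ y j) → y 0 + y 1 = 1 → OptimalVec A B y →
      y = ![1, 0]) ∧
    A.mulVec ![1, 0] ≠ (cwRho A B).toReal • B.mulVec ![1, 0] := by
  subst hAdef hBdef
  have ha0 : 0 < a := hb.trans hba
  have ha1 : 0 < 1 - a := by linarith
  have hpos : ∀ (k : ℕ) (j : Fin 2), 0 < (![1, 1 / ((k : ℝ) + 1)] : Fin 2 → ℝ) j := by
    intro k j
    fin_cases j
    · exact one_pos
    · exact Nat.one_div_pos_of_nat
  have hlim := tendsto_cwR_one_inv hb hba ha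
  have hne : ∀ x : Fin 2 → ℝ, (∀ j, 0 < x j) → x ≠ 0 := fun x hx h =>
    (hx 0).ne' (by simp [h])
  have hrho : cwRho !![a, 1-a; b, 1-b] !![1-a, a; 1-b, b] = ENNReal.ofReal (a/(1-a)) := by
    refine le_antisymm (ge_of_tendsto' hlim fun k => sInf_le ⟨_, hpos k, rfl⟩) (le_sInf ?_)
    rintro _ ⟨x, hx, rfl⟩
    exact ofReal_div_le_cwR ha0 ha (fun j => (hx j).le) (hne x hx)
  have hrhoHat : cwRhoHat !![a, 1-a; b, 1-b] !![1-a, a; 1-b, b] =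
      ENNReal.ofReal (a/(1-a)) := by
    refine le_antisymm (ge_of_tendsto' hlim fun k =>
      sInf_le ⟨_, fun j => (hpos k j).le, hne _ (hpos k), rfl⟩) (le_sInf ?_)
    rintro _ ⟨x, hx, hx0, rfl⟩
    exact ofReal_div_le_cwR ha0 ha hx hx0
  refine ⟨hrho, hrhoHat, ?_, ⟨?_, ?_, ?_, _, hpos, ?_, ?_⟩, ?_, ?_⟩
  · rw [div_lt_one ha1]
    linarith
  · simp [Fin.forall_fin_two]
  · exact fun h => one_ne_zero (congrFun h 0)
  · rw [hrho, cwR_eq_ofReal_firstRow_div hb hba ha] <;> simp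
  · rw [tendsto_pi_nhds, Fin.forall_fin_two]
    exact ⟨tendsto_const_nhds, tendsto_one_div_add_atTop_nhds_zero_nat⟩
  · rwa [hrho]
  · rintro y hy hsum ⟨-, hy0, hyr, -⟩
    have hd := firstRow_pos ha0 (by linarith) hy hy0
    have h := ofReal_firstRow_div_le_cwR (b := b) hd
    rw [hyr, hrho, ENNReal.ofReal_le_ofReal_iff (by positivity), div_le_div_iff₀ hd ha1] at h
    have h1 : y 1 = 0 := by nlinarith [hy 1]
    have h0 : y 0 = 1 := by linarith
    ext j
    fin_cases j <;> simp [h0, h1]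
  · intro h
    rw [hrho, ENNReal.toReal_ofReal (by positivity)] at h
    have h1 := congrFun h 1
    simp [Matrix.mulVec, dotProduct, Fin.sum_univ_two] at h1
    rw [div_mul_eq_mul_div, eq_div_iff ha1.ne'] at h1
    linarith
end

section
/- Let A = [a_{ij}], B = [b_{ij}] ∈ ℝ_+^{m×n} be a WN-pair and assume a_{ij} > 0 whenever b_{ij} = 0. Then the pair (A,B) is S-irreducible: for every subset K ⊆ [n] of cardinality m such that the submatrix B[[m],K] is monomial, the matrix B[[m],K]^{-1} A[[m],K] is irreducible. -/
open Matrix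
open scoped ENNReal

/-- A WN-pair: `A, B` nonnegative `m×n` matrices with `m ≤ n`, `B` has no zero row,
and every column of `B` has exactly one positive entry. -/
def WNpair {m n : ℕ} (A B : Matrix (Fin m) (Fin n) ℝ) : Prop :=
  m ≤ n ∧ (∀ i j, 0 ≤ A i j) ∧ (∀ i j, 0 ≤ B i j) ∧
  (∀ i, ∃ j, 0 < B i j) ∧ (∀ j, ∃! i, 0 < B i j)

/-- A square nonnegative matrix is monomial if each row and each column has exactly
one positive entry. -/
def IsMonomial {m : ℕ} (C : Matrix (Fin m) (Fin m) ℝ) : Prop :=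
  (∀ i j, 0 ≤ C i j) ∧ (∀ i, ∃! j, 0 < C i j) ∧ (∀ j, ∃! i, 0 < C i j)

/-- A nonnegative square matrix is irreducible if its associated digraph is strongly
connected, equivalently for all `i j` some power has positive `(i,j)` entry. -/
def MatIrreducible {m : ℕ} (C : Matrix (Fin m) (Fin m) ℝ) : Prop :=
  ∀ i j : Fin m, ∃ k : ℕ, 0 < (C ^ k) i j

/-- A row of a monomial matrix acts on a vector through its unique positive entry. -/
lemma IsMonomial.mulVec_apply {m : ℕ} {M : Matrix (Fin m) (Fin m) ℝ} (hM : IsMonomial M)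
    {r i : Fin m} (hr : 0 < M r i) (v : Fin m → ℝ) : (M *ᵥ v) r = M r i * v i := by
  refine Finset.sum_eq_single i (fun j _ hj => ?_) fun h => (h (Finset.mem_univ i)).elim
  have hz : M r j = 0 := by
    by_contra h
    exact hj ((hM.2.1 r).unique ((hM.1 r j).lt_of_ne' h) hr)
  simp [hz]

lemma IsMonomial.isUnit {m : ℕ} {M : Matrix (Fin m) (Fin m) ℝ} (hM : IsMonomial M) :
    IsUnit M := by
  rw [← Matrix.mulVec_injective_iff_isUnit]
  intro v w hvw
  ext i
  obtain ⟨r, hr, -⟩ := hM.2.2 i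
  have h := congrFun hvw r
  simp only [hM.mulVec_apply hr] at h
  exact mul_left_cancel₀ hr.ne' h

/-- If `(A,B)` is a WN-pair with `a_{ij} > 0` whenever `b_{ij} = 0`, then the pair is
S-irreducible: for every choice of `m` columns (given by an injection `e`) for which
the corresponding submatrix of `B` is monomial, `B[[m],K]⁻¹ A[[m],K]` is irreducible. -/
theorem stmt16 {m n : ℕ} (hm : 0 < m)
    (A B : Matrix (Fin m) (Fin n) ℝ)
    (hWN : WNpair A B)
    (hcond : ∀ i j, B i j = 0 → 0 < A i j) :
    ∀ e : Fin m → Fin n, Function.Injective e →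
      IsMonomial (Matrix.of fun i k => B i (e k)) →
      MatIrreducible ((Matrix.of fun i k => B i (e k))⁻¹ *
        (Matrix.of fun i k => A i (e k))) := by
  intro e _ hM
  set M := Matrix.of fun i k => B i (e k)
  set N := Matrix.of fun i k => A i (e k)
  intro i j
  rcases eq_or_ne i j with rfl | hij
  · exact ⟨0, by simp⟩
  obtain ⟨r, hr, -⟩ := hM.2.2 i
  have hz : M r j = 0 := by
    by_contra h
    exact hij ((hM.2.1 r).unique hr ((hM.1 r j).lt_of_ne' h))
  have hN : 0 < N r j := hcond r (e j) hz
  have hmul : M * (M⁻¹ * N) = N :=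
    Matrix.mul_nonsing_inv_cancel_left M N ((Matrix.isUnit_iff_isUnit_det M).mp hM.isUnit)
  have hrow : N r j = M r i * (M⁻¹ * N) i j := by
    conv_lhs => rw [← hmul]
    exact hM.mulVec_apply hr fun k => (M⁻¹ * N) k j
  refine ⟨1, ?_⟩
  rw [pow_one]
  exact pos_of_mul_pos_right (hrow ▸ hN) hr.le
end

section
/- Let 𝒜, ℬ be completely positive operators from n×n to m×m Hermitian matrices. (1) If 𝒜∨(I_m) is positive definite, then ρ̂(𝒜,ℬ) ≥ ρ(𝒜∨(I_m)^{-1} ℬ∨(I_m))^{-1}, where ρ denotes the spectral radius. (2) In particular, if 𝒜 and ℬ are both quantum channels (trace preserving, i.e., their defining Kraus operators T_j satisfy ∑_j T_j^* T_j = I_n), then ρ̂(𝒜,ℬ) ≥ 1. -/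
open Matrix
open scoped ENNReal ComplexOrder

/-- The completely positive operator with Kraus operators `T j`:
`X ↦ ∑ j, T j * X * (T j)ᴴ`. -/
noncomputable def cpMap {n m k : ℕ} (T : Fin k → Matrix (Fin m) (Fin n) ℂ)
    (X : Matrix (Fin n) (Fin n) ℂ) : Matrix (Fin m) (Fin m) ℂ :=
  ∑ j, T j * X * (T j)ᴴ

/-- `r(𝒜,ℬ,X) = inf{t ∈ [0,∞] : t ℬ(X) - 𝒜(X) is positive semidefinite}`, valued in
`ℝ≥0∞` (the infimum of the empty set being `⊤`), where `𝒜, ℬ` are the CP operators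
with Kraus families `T, S`. -/
noncomputable def cpR {n m k₁ k₂ : ℕ} (T : Fin k₁ → Matrix (Fin m) (Fin n) ℂ)
    (S : Fin k₂ → Matrix (Fin m) (Fin n) ℂ) (X : Matrix (Fin n) (Fin n) ℂ) : ℝ≥0∞ :=
  sInf {t : ℝ≥0∞ | ∃ s : ℝ, 0 ≤ s ∧ t = ENNReal.ofReal s ∧
    ((s : ℂ) • cpMap S X - cpMap T X).PosSemidef}

/-- The weak Collatz–Wielandt quotient
`ρ̂(𝒜,ℬ) = inf{r(𝒜,ℬ,X) : X ∈ H_{+,n}, X ≠ 0}`. -/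
noncomputable def cpRhoHat {n m k₁ k₂ : ℕ} (T : Fin k₁ → Matrix (Fin m) (Fin n) ℂ)
    (S : Fin k₂ → Matrix (Fin m) (Fin n) ℂ) : ℝ≥0∞ :=
  sInf {t : ℝ≥0∞ | ∃ X : Matrix (Fin n) (Fin n) ℂ, X.PosSemidef ∧ X ≠ 0 ∧
    t = cpR T S X}

/-- The spectral radius of a complex square matrix. -/
noncomputable def specRadC {n : ℕ} (C : Matrix (Fin n) (Fin n) ℂ) : ℝ≥0∞ :=
  spectralRadius ℂ C

open scoped MatrixOrder in
theorem Matrix.PosSemidef.trace_mul_nonneg {n : ℕ} {P X : Matrix (Fin n) (Fin n) ℂ}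
    (hP : P.PosSemidef) (hX : X.PosSemidef) : 0 ≤ (P * X).trace := by
  obtain ⟨y, rfl⟩ := CStarAlgebra.nonneg_iff_eq_star_mul_self.mp hP.nonneg
  rw [mul_assoc, trace_mul_comm, star_eq_conjTranspose]
  exact (hX.mul_mul_conjTranspose_same y).trace_nonneg

open scoped MatrixOrder in
theorem Matrix.PosDef.trace_mul_pos {n : ℕ} {P X : Matrix (Fin n) (Fin n) ℂ}
    (hP : P.PosDef) (hX : X.PosSemidef) (hX0 : X ≠ 0) : 0 < (P * X).trace := by
  refine lt_of_le_of_ne (hP.posSemidef.trace_mul_nonneg hX) fun h ↦ hX0 ?_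
  obtain ⟨y, hy, rfl⟩ :=
    CStarAlgebra.isStrictlyPositive_iff_eq_star_mul_self.mp hP.isStrictlyPositive
  rw [mul_assoc, trace_mul_comm, star_eq_conjTranspose, eq_comm,
    (hX.mul_mul_conjTranspose_same y).trace_eq_zero_iff] at h
  have hy' : IsUnit yᴴ := hy.star
  rwa [hy'.mul_left_eq_zero, hy.mul_right_eq_zero] at h

theorem trace_cpMap {n m k : ℕ} (T : Fin k → Matrix (Fin m) (Fin n) ℂ)
    (X : Matrix (Fin n) (Fin n) ℂ) :
    (cpMap T X).trace = ((∑ j, (T j)ᴴ * T j) * X).trace := by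
  simp only [cpMap, Finset.sum_mul, trace_sum]
  refine Finset.sum_congr rfl fun j _ ↦ ?_
  rw [trace_mul_comm, Matrix.mul_assoc]

open scoped MatrixOrder in
/-- If `A` is positive definite and `D` is Hermitian, then `D ≤ ρ(A⁻¹ D) A` in the Loewner order. -/
theorem posSemidef_smul_sub_of_specRadC_le {n : ℕ} {A D : Matrix (Fin n) (Fin n) ℂ}
    (hA : A.PosDef) (hD : D.IsHermitian) {r : ℝ}
    (hr : specRadC (A⁻¹ * D) ≤ ENNReal.ofReal r) (hr0 : 0 ≤ r) :
    ((r : ℂ) • A - D).PosSemidef := by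
  obtain ⟨y, hy, rfl⟩ :=
    CStarAlgebra.isStrictlyPositive_iff_eq_star_mul_self.mp hA.isStrictlyPositive
  have hdet : IsUnit y.det := (isUnit_iff_isUnit_det y).mp hy
  have hdet' : IsUnit yᴴ.det := (isUnit_iff_isUnit_det _).mp hy.star
  set M : Matrix (Fin n) (Fin n) ℂ := y⁻¹ᴴ * D * y⁻¹ with hM
  have hMH : M.IsHermitian := isHermitian_conjTranspose_mul_mul _ hD
  have hspec : spectrum ℂ M = spectrum ℂ ((star y * y)⁻¹ * D) := by
    lift y to (Matrix (Fin n) (Fin n) ℂ)ˣ using hy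
    rw [← spectrum.units_conjugate' (u := y)]
    congr 1
    rw [hM, coe_units_inv, Matrix.mul_inv_rev, star_eq_conjTranspose, conjTranspose_nonsing_inv]
    simp only [mul_assoc, nonsing_inv_mul _ hdet, mul_one]
  have hyM : star y * M * y = D := by
    rw [hM, star_eq_conjTranspose, conjTranspose_nonsing_inv]
    simp only [mul_assoc, nonsing_inv_mul _ hdet, mul_one]
    rw [mul_nonsing_inv_cancel_left _ _ hdet']
  have hle : ((r : ℂ) • 1 - M).PosSemidef := by
    have hH : ((r : ℂ) • 1 - M).IsHermitian := by
      refine IsHermitian.sub ?_ hMH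
      simp [IsHermitian, conjTranspose_smul]
    rw [hH.posSemidef_iff_eigenvalues_nonneg]
    intro i
    generalize hlam : hH.eigenvalues i = lam
    have hi : (lam : ℂ) ∈ spectrum ℂ ((r : ℂ) • 1 - M) := by
      rw [hH.spectrum_eq_image_range]
      exact ⟨_, ⟨i, rfl⟩, congrArg _ hlam⟩
    rw [← Algebra.algebraMap_eq_smul_one, ← spectrum.singleton_sub_eq, Set.singleton_sub] at hi
    obtain ⟨μ, hμ, hμi⟩ := hi
    have hnorm : ‖μ‖ ≤ r := by
      have h := (le_iSup₂ (f := fun (k : ℂ) (_ : k ∈ spectrum ℂ ((star y * y)⁻¹ * D)) ↦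
        (‖k‖₊ : ℝ≥0∞)) μ (hspec ▸ hμ)).trans hr
      rwa [← enorm_eq_nnnorm, ← ofReal_norm, ENNReal.ofReal_le_ofReal_iff hr0] at h
    have hre := congrArg Complex.re hμi
    simp only [Complex.sub_re, Complex.ofReal_re] at hre
    simp only [Pi.zero_apply]
    linarith [Complex.re_le_norm μ]
  have h := hle.conjTranspose_mul_mul_same y
  rwa [mul_sub, sub_mul, ← star_eq_conjTranspose, hyM, mul_smul_comm, mul_one, smul_mul_assoc] at h

theorem inv_ofReal_le_cpRhoHat {n m k₁ k₂ : ℕ} {T : Fin k₁ → Matrix (Fin m) (Fin n) ℂ}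
    {S : Fin k₂ → Matrix (Fin m) (Fin n) ℂ} {r : ℝ} (hr0 : 0 ≤ r)
    (hT : (∑ j, (T j)ᴴ * T j).PosDef)
    (h : ((r : ℂ) • (∑ j, (T j)ᴴ * T j) - ∑ j, (S j)ᴴ * S j).PosSemidef) :
    (ENNReal.ofReal r)⁻¹ ≤ cpRhoHat T S := by
  refine le_sInf ?_
  rintro _ ⟨X, hX, hX0, rfl⟩
  refine le_sInf ?_
  rintro _ ⟨s, hs, rfl, hpos⟩
  have h1 := hpos.trace_nonneg
  have h2 := h.trace_mul_nonneg hX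
  have h3 := hT.trace_mul_pos hX hX0
  rw [trace_sub, trace_smul, trace_cpMap, trace_cpMap, smul_eq_mul] at h1
  rw [sub_mul, trace_sub, smul_mul_assoc, trace_smul, smul_eq_mul] at h2
  generalize ((∑ j, (T j)ᴴ * T j) * X).trace = a at h1 h2 h3
  generalize ((∑ j, (S j)ᴴ * S j) * X).trace = d at h1 h2
  replace h1 := (Complex.le_def.mp h1).1
  replace h2 := (Complex.le_def.mp h2).1
  replace h3 := (Complex.lt_def.mp h3).1
  simp only [Complex.sub_re, Complex.re_ofReal_mul, Complex.zero_re] at h1 h2 h3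
  have hsr : 1 ≤ s * r := by
    by_contra! hlt
    nlinarith [mul_le_mul_of_nonneg_left (sub_nonneg.mp h2) hs, mul_pos h3 (sub_pos.mpr hlt)]
  have hrpos : 0 < r := lt_of_le_of_ne hr0 (by rintro rfl; norm_num at hsr)
  rw [← ENNReal.ofReal_inv_of_pos hrpos]
  refine ENNReal.ofReal_le_ofReal ?_
  rwa [inv_le_iff_one_le_mul₀ hrpos]

/-- (1) If `𝒜∨(I_m) = ∑ⱼ Tⱼᴴ Tⱼ` is positive definite, then
`ρ̂(𝒜,ℬ) ≥ ρ(𝒜∨(I_m)⁻¹ ℬ∨(I_m))⁻¹`.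
(2) If `𝒜` and `ℬ` are quantum channels (`∑ⱼ Tⱼᴴ Tⱼ = ∑ⱼ Sⱼᴴ Sⱼ = I_n`),
then `ρ̂(𝒜,ℬ) ≥ 1`. -/
theorem stmt18 {n m k₁ k₂ : ℕ} (hn : 0 < n) (hmoreover : 0 < m)
    (T : Fin k₁ → Matrix (Fin m) (Fin n) ℂ)
    (S : Fin k₂ → Matrix (Fin m) (Fin n) ℂ) :
    ((∑ j, (T j)ᴴ * T j).PosDef →
      (specRadC ((∑ j, (T j)ᴴ * T j)⁻¹ * ∑ j, (S j)ᴴ * S j))⁻¹ ≤ cpRhoHat T S) ∧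
    ((∑ j, (T j)ᴴ * T j) = 1 → (∑ j, (S j)ᴴ * S j) = 1 → 1 ≤ cpRhoHat T S) := by
  constructor
  · intro hT
    have hS : (∑ j, (S j)ᴴ * S j).IsHermitian := by
      simp [IsHermitian, conjTranspose_sum]
    by_cases htop : specRadC ((∑ j, (T j)ᴴ * T j)⁻¹ * ∑ j, (S j)ᴴ * S j) = ⊤
    · simp [htop]
    · have hr := ENNReal.ofReal_toReal htop
      have h := inv_ofReal_le_cpRhoHat ENNReal.toReal_nonneg hT
        (posSemidef_smul_sub_of_specRadC_le hT hS hr.ge ENNReal.toReal_nonneg)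
      rwa [hr] at h
  · intro hT hS
    have h := inv_ofReal_le_cpRhoHat (T := T) (S := S) zero_le_one (hT ▸ PosDef.one)
      (by simpa [hT, hS] using PosSemidef.zero)
    simpa using h
end

section
/- Let 𝒜, ℬ be completely positive operators from n×n to m×m Hermitian matrices with 0 < ρ̂(𝒜,ℬ) < ∞. Then every minimal weakly optimal Y ∈ H_{+,n} has rank at most m. -/
open Matrix
open scoped ENNReal ComplexOrder

/-- `Y` is weakly optimal for the CP pair. -/
def CpWeaklyOptimal {n m k₁ k₂ : ℕ} (T : Fin k₁ → Matrix (Fin m) (Fin n) ℂ)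
    (S : Fin k₂ → Matrix (Fin m) (Fin n) ℂ) (Y : Matrix (Fin n) (Fin n) ℂ) : Prop :=
  Y.PosSemidef ∧ Y ≠ 0 ∧ cpR T S Y = cpRhoHat T S

theorem cpMap_posSemidef {n m k : ℕ} (T : Fin k → Matrix (Fin m) (Fin n) ℂ)
    {X : Matrix (Fin n) (Fin n) ℂ} (hX : X.PosSemidef) : (cpMap T X).PosSemidef :=
  posSemidef_sum _ fun j _ => hX.mul_mul_conjTranspose_same (T j)

theorem cpMap_conjTranspose {n m k : ℕ} (T : Fin k → Matrix (Fin m) (Fin n) ℂ)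
    (X : Matrix (Fin n) (Fin n) ℂ) : cpMap T Xᴴ = (cpMap T X)ᴴ := by
  simp [cpMap, conjTranspose_sum, Matrix.mul_assoc]

/-- The completely positive operator as a complex linear map. -/
noncomputable def cpLinearMap {n m k : ℕ} (T : Fin k → Matrix (Fin m) (Fin n) ℂ) :
    Matrix (Fin n) (Fin n) ℂ →ₗ[ℂ] Matrix (Fin m) (Fin m) ℂ where
  toFun := cpMap T
  map_add' X Y := by simp [cpMap, Matrix.mul_add, Matrix.add_mul, Finset.sum_add_distrib]
  map_smul' c X := by simp [cpMap, Finset.smul_sum]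

/-- The infimum defining `cpR` is attained when it is finite. -/
theorem exists_cpR_eq_ofReal {n m k₁ k₂ : ℕ} {T : Fin k₁ → Matrix (Fin m) (Fin n) ℂ}
    {S : Fin k₂ → Matrix (Fin m) (Fin n) ℂ} {X : Matrix (Fin n) (Fin n) ℂ}
    (hX : X.PosSemidef) (hfin : cpR T S X < ⊤) :
    ∃ s : ℝ, 0 ≤ s ∧ cpR T S X = ENNReal.ofReal s ∧
      ((s : ℂ) • cpMap S X - cpMap T X).PosSemidef := by
  set A : Set ℝ := {s | 0 ≤ s ∧ ((s : ℂ) • cpMap S X - cpMap T X).PosSemidef} with hA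
  have hne : A.Nonempty := by
    obtain ⟨t, ⟨s, hs, -, hs'⟩, -⟩ := sInf_lt_iff.1 hfin
    exact ⟨s, hs, hs'⟩
  have hbdd : BddBelow A := ⟨0, fun s hs => hs.1⟩
  have hherm (s : ℝ) : ((s : ℂ) • cpMap S X - cpMap T X).IsHermitian := by
    rw [IsHermitian, conjTranspose_sub, conjTranspose_smul,
      (cpMap_posSemidef S hX).isHermitian.eq, (cpMap_posSemidef T hX).isHermitian.eq]
    simp
  have hclosed : IsClosed A := by
    have hAeq : A = {s | 0 ≤ s} ∩ ⋂ v : Fin m → ℂ,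
        {s : ℝ | 0 ≤ (s : ℂ) * (star v ⬝ᵥ cpMap S X *ᵥ v) - star v ⬝ᵥ cpMap T X *ᵥ v} := by
      ext s
      simp only [hA, Set.mem_ofPred_eq, posSemidef_iff_dotProduct_mulVec, hherm s, true_and,
        Set.mem_inter_iff, Set.mem_iInter, sub_mulVec, smul_mulVec, dotProduct_sub,
        dotProduct_smul, smul_eq_mul]
    rw [hAeq]
    refine isClosed_Ici.inter (isClosed_iInter fun v => isClosed_le continuous_const ?_)
    fun_prop
  obtain ⟨h0, hpsd⟩ := hclosed.csInf_mem hne hbdd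
  refine ⟨sInf A, h0, le_antisymm (sInf_le ⟨_, h0, rfl, hpsd⟩) (le_sInf ?_), hpsd⟩
  rintro _ ⟨s, hs, rfl, hs'⟩
  exact ENNReal.ofReal_le_ofReal (csInf_le hbdd ⟨hs, hs'⟩)

namespace Matrix

theorem IsHermitian.eq_mul_diagonal_eigenvalues_mul {n : Type*} [Fintype n] [DecidableEq n]
    {A : Matrix n n ℂ} (hA : A.IsHermitian) :
    A = (hA.eigenvectorUnitary : Matrix n n ℂ) * diagonal (fun i => (hA.eigenvalues i : ℂ)) *
      (hA.eigenvectorUnitary : Matrix n n ℂ)ᴴ := by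
  conv_lhs => rw [hA.spectral_theorem, Unitary.conjStarAlgAut_apply]
  rfl

/-- A positive semidefinite matrix factors as `P * Pᴴ` with `P` having full column rank. -/
theorem PosSemidef.exists_eq_mul_conjTranspose_rank {n : ℕ} {Y : Matrix (Fin n) (Fin n) ℂ}
    (hY : Y.PosSemidef) : ∃ P : Matrix (Fin n) (Fin Y.rank) ℂ, Y = P * Pᴴ := by
  have hH := hY.isHermitian
  set U : Matrix (Fin n) (Fin n) ℂ := hH.eigenvectorUnitary.1
  let e : Fin Y.rank ≃ {i // hH.eigenvalues i ≠ 0} :=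
    Fintype.equivOfCardEq (by rw [Fintype.card_fin, hH.rank_eq_card_non_zero_eigs])
  refine ⟨of fun i j => U i (e j) * (Real.sqrt (hH.eigenvalues (e j)) : ℂ), ?_⟩
  ext i j
  have hlhs : Y i j = ∑ k, U i k * (hH.eigenvalues k : ℂ) * star (U j k) := by
    conv_lhs => rw [hH.eq_mul_diagonal_eigenvalues_mul]
    rw [mul_apply]
    simp only [mul_diagonal, conjTranspose_apply, U]
  rw [hlhs, mul_apply]
  simp only [of_apply, conjTranspose_apply]
  rw [e.sum_comp fun k => (U i k * (Real.sqrt (hH.eigenvalues k) : ℂ)) *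
      star (U j k * (Real.sqrt (hH.eigenvalues k) : ℂ)),
    ← Finset.sum_subtype (Finset.univ.filter fun k => hH.eigenvalues k ≠ 0) (by simp)
      fun k => (U i k * (Real.sqrt (hH.eigenvalues k) : ℂ)) *
        star (U j k * (Real.sqrt (hH.eigenvalues k) : ℂ)), Finset.sum_filter]
  refine Finset.sum_congr rfl fun k _ => ?_
  have hsq : (hH.eigenvalues k : ℂ) =
      (Real.sqrt (hH.eigenvalues k) : ℂ) * (Real.sqrt (hH.eigenvalues k) : ℂ) := by
    exact_mod_cast (Real.mul_self_sqrt (hY.eigenvalues_nonneg k)).symm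
  split_ifs with hk
  · simp only [star_mul', Complex.star_def, Complex.conj_ofReal]
    conv_lhs => rw [hsq]
    ring
  · simp [not_not.1 hk]

/-- Shifting a Hermitian matrix by its least eigenvalue gives a singular positive semidefinite
matrix. -/
theorem IsHermitian.exists_sub_smul_one_posSemidef {r : ℕ} (hr : 0 < r)
    {W : Matrix (Fin r) (Fin r) ℂ} (hW : W.IsHermitian) :
    ∃ c : ℝ, (W - (c : ℂ) • 1).PosSemidef ∧ (W - (c : ℂ) • 1).rank < r := by
  have : Nonempty (Fin r) := ⟨⟨0, hr⟩⟩
  obtain ⟨i, hi⟩ := Finite.exists_min hW.eigenvalues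
  set U : Matrix (Fin r) (Fin r) ℂ := hW.eigenvectorUnitary.1
  have hUU : U * Uᴴ = 1 := Unitary.coe_mul_star_self hW.eigenvectorUnitary
  have key : W - (hW.eigenvalues i : ℂ) • 1 =
      U * diagonal (fun j => ((hW.eigenvalues j - hW.eigenvalues i : ℝ) : ℂ)) * Uᴴ := by
    have hd : diagonal (fun j => ((hW.eigenvalues j - hW.eigenvalues i : ℝ) : ℂ)) =
        diagonal (fun j => (hW.eigenvalues j : ℂ)) - (hW.eigenvalues i : ℂ) • 1 := by
      ext a b
      by_cases h : a = b <;> simp [h]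
    rw [hd, Matrix.mul_sub, Matrix.sub_mul, ← hW.eq_mul_diagonal_eigenvalues_mul]
    simp [hUU]
  refine ⟨hW.eigenvalues i, ?_, ?_⟩
  · rw [key]
    refine PosSemidef.mul_mul_conjTranspose_same (PosSemidef.diagonal fun j => ?_) U
    exact Complex.zero_le_real.2 (sub_nonneg.2 (hi j))
  · rw [key]
    refine ((rank_mul_le_left _ _).trans (rank_mul_le_right _ _)).trans_lt ?_
    rw [rank_diagonal]
    refine (Fintype.card_subtype_lt (x := i) (by simp)).trans_eq (Fintype.card_fin r)

end Matrix

/-- A Hermitian-preserving map into a smaller matrix space has a nonscalar Hermitian matrix in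
its kernel. -/
theorem exists_isHermitian_map_eq_zero {r m : ℕ} (hm : 0 < m) (hrm : m < r)
    (f : Matrix (Fin r) (Fin r) ℂ →ₗ[ℂ] Matrix (Fin m) (Fin m) ℂ)
    (hf : ∀ X, f Xᴴ = (f X)ᴴ) :
    ∃ W : Matrix (Fin r) (Fin r) ℂ, W.IsHermitian ∧ f W = 0 ∧ ∀ c : ℂ, W ≠ c • 1 := by
  obtain ⟨X, hX, hX1⟩ : ∃ X, f X = 0 ∧ ∀ c : ℂ, X ≠ c • 1 := by
    by_contra! h
    have hle : LinearMap.ker f ≤ ℂ ∙ (1 : Matrix (Fin r) (Fin r) ℂ) := fun X hX => by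
      obtain ⟨c, rfl⟩ := h X hX
      exact Submodule.smul_mem _ _ (Submodule.mem_span_singleton_self _)
    have h1 := (Submodule.finrank_mono hle).trans (finrank_span_le_card _)
    have h2 := f.finrank_range_add_finrank_ker
    have h3 := (LinearMap.range f).finrank_le
    simp only [Module.finrank_matrix, Fintype.card_fin, Module.finrank_self] at h2 h3
    rw [Set.toFinset_singleton, Finset.card_singleton] at h1
    nlinarith [Nat.mul_le_mul hrm hrm]
  by_contra! h
  obtain ⟨a, ha⟩ := h (X + Xᴴ) (by simp [IsHermitian, add_comm]) (by simp [hf, hX])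
  obtain ⟨b, hb⟩ := h (Complex.I • (X - Xᴴ))
    (by simp [IsHermitian, ← smul_neg]) (by simp [hf, hX])
  refine hX1 ((a - Complex.I * b) / 2) ?_
  have hb' : X - Xᴴ = (-Complex.I * b) • (1 : Matrix (Fin r) (Fin r) ℂ) := by
    rw [mul_smul, ← hb, smul_smul]
    simp
  have h2 : (2 : ℂ) • X = (a - Complex.I * b) • (1 : Matrix (Fin r) (Fin r) ℂ) := by
    rw [sub_eq_add_neg, add_smul, ← neg_mul, ← ha, ← hb', two_smul]
    abel
  rw [div_eq_inv_mul, mul_smul, ← h2, smul_smul]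
  simp

/-- A Hermitian-preserving map into a smaller matrix space that is positive at the identity is
positive at some nonzero singular positive semidefinite matrix. -/
theorem exists_singular_posSemidef_map_posSemidef {r m : ℕ} (hm : 0 < m) (hrm : m < r)
    (f : Matrix (Fin r) (Fin r) ℂ →ₗ[ℂ] Matrix (Fin m) (Fin m) ℂ)
    (hf : ∀ X, f Xᴴ = (f X)ᴴ) (h1 : (f 1).PosSemidef) :
    ∃ V : Matrix (Fin r) (Fin r) ℂ, V.PosSemidef ∧ V ≠ 0 ∧ V.rank < r ∧ (f V).PosSemidef := by
  obtain ⟨W, hW, hfW, hWc⟩ := exists_isHermitian_map_eq_zero hm hrm f hf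
  have hr : 0 < r := by omega
  have main : ∀ W : Matrix (Fin r) (Fin r) ℂ, f W = 0 → (∀ c : ℂ, W ≠ c • 1) → ∀ c : ℝ, c ≤ 0 →
      (W - (c : ℂ) • 1).PosSemidef → (W - (c : ℂ) • 1).rank < r →
      ∃ V : Matrix (Fin r) (Fin r) ℂ, V.PosSemidef ∧ V ≠ 0 ∧ V.rank < r ∧ (f V).PosSemidef := by
    intro W hfW hWc c hc hpsd hrank
    refine ⟨_, hpsd, sub_ne_zero.2 (hWc c), hrank, ?_⟩
    rw [map_sub, hfW, map_smul, zero_sub, ← neg_smul]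
    exact h1.smul (by exact_mod_cast neg_nonneg.2 hc)
  obtain ⟨c, hc, hcr⟩ := hW.exists_sub_smul_one_posSemidef hr
  obtain ⟨d, hd, hdr⟩ := hW.neg.exists_sub_smul_one_posSemidef hr
  rcases le_or_gt c 0 with hc0 | hc0
  · exact main W hfW hWc c hc0 hc hcr
  · refine main (-W) (by simp [hfW]) (fun a ha => hWc (-a) ?_) d ?_ hd hdr
    · rw [neg_smul, ← ha, neg_neg]
    · have hsum : (W - (c : ℂ) • 1) + (-W - (d : ℂ) • 1) =
          ((-c - d : ℝ) : ℂ) • (1 : Matrix (Fin r) (Fin r) ℂ) := by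
        push_cast
        module
      have hdiag := (hc.add hd).diag_nonneg (i := ⟨0, hr⟩)
      rw [hsum, Matrix.smul_apply, one_apply_eq, smul_eq_mul, mul_one, Complex.zero_le_real] at hdiag
      linarith

/-- If `0 < ρ̂(𝒜,ℬ) < ∞`, then a minimal weakly optimal `Y ∈ H_{+,n}`
(no weakly optimal `X` has range strictly contained in the range of `Y`)
has rank at most `m`. -/
theorem stmt19 {n m k₁ k₂ : ℕ} (hn : 0 < n) (hmpos : 0 < m)
    (T : Fin k₁ → Matrix (Fin m) (Fin n) ℂ)
    (S : Fin k₂ → Matrix (Fin m) (Fin n) ℂ)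
    (hpos : 0 < cpRhoHat T S) (hfin : cpRhoHat T S < ⊤)
    (Y : Matrix (Fin n) (Fin n) ℂ)
    (hY : CpWeaklyOptimal T S Y)
    (hmin : ∀ X : Matrix (Fin n) (Fin n) ℂ, CpWeaklyOptimal T S X →
      ¬ LinearMap.range X.mulVecLin < LinearMap.range Y.mulVecLin) :
    Y.rank ≤ m := by
  by_contra! hlt
  obtain ⟨hYpsd, hY0, hYr⟩ := hY
  obtain ⟨s, hs, hsr, hspsd⟩ := exists_cpR_eq_ofReal hYpsd (hYr ▸ hfin)
  obtain ⟨P, hP⟩ := hYpsd.exists_eq_mul_conjTranspose_rank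
  let f : Matrix (Fin Y.rank) (Fin Y.rank) ℂ →ₗ[ℂ] Matrix (Fin m) (Fin m) ℂ :=
    ((s : ℂ) • cpLinearMap S - cpLinearMap T) ∘ₗ
      (mulRightLinearMap (Fin n) ℂ Pᴴ ∘ₗ mulLeftLinearMap (Fin Y.rank) ℂ P)
  have hf (X) : f X = (s : ℂ) • cpMap S (P * X * Pᴴ) - cpMap T (P * X * Pᴴ) := rfl
  obtain ⟨V, hV, hV0, hVr, hfV⟩ := exists_singular_posSemidef_map_posSemidef hmpos hlt f
    (fun X => by
      have h : P * Xᴴ * Pᴴ = (P * X * Pᴴ)ᴴ := by simp [Matrix.mul_assoc]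
      rw [hf, hf, h, cpMap_conjTranspose, cpMap_conjTranspose]
      simp)
    (by rwa [hf, Matrix.mul_one, ← hP])
  have hPrank : P.rank = Y.rank := by
    conv_rhs => rw [hP, rank_self_mul_conjTranspose]
  have hPP : IsUnit (Pᴴ * P) := by
    rw [← mulVec_surjective_iff_isUnit]
    refine (LinearMap.range_eq_top (f := (Pᴴ * P).mulVecLin)).1
      (Submodule.eq_top_of_finrank_eq ?_)
    exact (rank_conjTranspose_mul_self P).trans (by simp [hPrank])
  have hXpsd : (P * V * Pᴴ).PosSemidef := hV.mul_mul_conjTranspose_same P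
  have hX0 : P * V * Pᴴ ≠ 0 := fun h => hV0 <| by
    have h' : Pᴴ * P * V * (Pᴴ * P) = 0 := by
      have : Pᴴ * P * V * (Pᴴ * P) = Pᴴ * (P * V * Pᴴ) * P := by simp only [Matrix.mul_assoc]
      rw [this, h, Matrix.mul_zero, Matrix.zero_mul]
    exact hPP.mul_right_eq_zero.1 (hPP.mul_left_eq_zero.1 h')
  refine hmin (P * V * Pᴴ) ⟨hXpsd, hX0, le_antisymm ?_ (sInf_le ⟨_, hXpsd, hX0, rfl⟩)⟩ ?_
  · rw [← hYr, hsr]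
    exact sInf_le ⟨s, hs, rfl, hfV⟩
  · have hYP : LinearMap.range Y.mulVecLin = LinearMap.range P.mulVecLin := by
      refine Submodule.eq_of_le_of_finrank_eq ?_ hPrank.symm
      conv_lhs => rw [hP, mulVecLin_mul]
      exact LinearMap.range_comp_le_range _ _
    refine lt_of_le_of_ne ?_ fun h => ?_
    · rw [hYP, Matrix.mul_assoc, mulVecLin_mul]
      exact LinearMap.range_comp_le_range _ _
    · have hrank : (P * V * Pᴴ).rank = Y.rank :=
        congrArg (fun K : Submodule ℂ (Fin n → ℂ) => Module.finrank ℂ K) h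
      have hle := (rank_mul_le_left (P * V) Pᴴ).trans (rank_mul_le_right P V)
      omega
end
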